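/- arXiv:2510.17029 — 2 statements merged into one kernel-verified Lean document; each statement's English description precedes it below -/
import Mathlib

section
/- Let (a₀,b₀) ∈ ℝ² be a point whose orbit O under G has cardinality 6, and set r² := a₀² + b₀² and γ := a₀³ − 3a₀b₀². Then the set {F ∈ ℂ[x,y,z] : F(ta, tb, t) = 0 for all (a,b) ∈ O and all t ∈ ℝ} is exactly the ideal of ℂ[x,y,z] generated by the two polynomials x² + y² − r²z² and x³ − 3xy² − γz³; moreover (x² + y² − r²z², x³ − 3xy² − γz³) is a regular sequence in ℂ[x,y,z], so this ideal is a complete intersection. -/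
open Complex MvPolynomial

noncomputable def rotPerm : Equiv.Perm ℂ :=
  Equiv.mulLeft₀ (Complex.exp (2 * Real.pi * Complex.I / 3)) (Complex.exp_ne_zero _)

noncomputable def conjPerm : Equiv.Perm ℂ :=
  ⟨fun z => (starRingEnd ℂ) z, fun z => (starRingEnd ℂ) z,
    fun z => by simp, fun z => by simp⟩

noncomputable def dihedralG : Subgroup (Equiv.Perm ℂ) :=
  Subgroup.closure {rotPerm, conjPerm}

def Gorbit (v : ℂ) : Set ℂ := {z : ℂ | ∃ g ∈ dihedralG, g v = z}

/-- The quadric `x² + y² - R z²`. -/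
noncomputable def quadric (R : ℂ) : MvPolynomial (Fin 3) ℂ :=
  X 0 ^ 2 + X 1 ^ 2 - C R * X 2 ^ 2

/-- The cubic `x³ - 3xy² - γ z³`. -/
noncomputable def cubic (γ : ℂ) : MvPolynomial (Fin 3) ℂ :=
  X 0 ^ 3 - 3 * X 0 * X 1 ^ 2 - C γ * X 2 ^ 3

theorem eval_quadric (R : ℂ) (v : Fin 3 → ℂ) :
    eval v (quadric R) = v 0 ^ 2 + v 1 ^ 2 - R * v 2 ^ 2 := by
  simp [quadric]

theorem eval_cubic (γ : ℂ) (v : Fin 3 → ℂ) :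
    eval v (cubic γ) = v 0 ^ 3 - 3 * v 0 * v 1 ^ 2 - γ * v 2 ^ 3 := by
  simp [cubic]

theorem eval_aeval_X {σ : Type*} (v : σ → ℂ) (i : σ) (p : Polynomial ℂ) :
    eval v (Polynomial.aeval (X i : MvPolynomial σ ℂ) p) = p.eval (v i) := by
  rw [← MvPolynomial.coe_aeval_eq_eval]
  exact (Polynomial.aeval_algHom_apply (aeval v) (X i) p).symm.trans (by simp)

/-- Every polynomial is linear in `y` modulo the quadric. -/
theorem exists_sub_mem_span_quadric (R : ℂ) (F : MvPolynomial (Fin 3) ℂ) :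
    ∃ A B : MvPolynomial (Fin 2) ℂ,
      F - (rename ![0, 2] A + rename ![0, 2] B * X 1) ∈ Ideal.span {quadric R} := by
  simp only [Ideal.mem_span_singleton']
  induction F using MvPolynomial.induction_on with
  | C a => exact ⟨C a, 0, 0, by simp⟩
  | add p q hp hq =>
    obtain ⟨A, B, g, h⟩ := hp
    obtain ⟨A', B', g', h'⟩ := hq
    refine ⟨A + A', B + B', g + g', ?_⟩
    simp only [map_add]
    linear_combination h + h'
  | mul_X p i hp =>
    obtain ⟨A, B, g, h⟩ := hp
    fin_cases i
    · refine ⟨A * X 0, B * X 0, g * X 0, ?_⟩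
      simp
      linear_combination X 0 * h
    · refine ⟨B * (C R * X 1 ^ 2 - X 0 ^ 2), A, g * X 1 + rename ![0, 2] B, ?_⟩
      simp
      simp only [quadric] at h ⊢
      linear_combination X 1 * h
    · refine ⟨A * X 1, B * X 1, g * X 2, ?_⟩
      simp
      linear_combination X 2 * h

/-- Modulo the quadric and the cubic, `ℂ[x,y,z]` is spanned over `ℂ[z]` by the monomials
`xⁱyʲ` with `i < 3` and `j < 2`. -/
theorem exists_sub_mem_span_quadric_cubic (R γ : ℂ) (F : MvPolynomial (Fin 3) ℂ) :
    ∃ p₀ p₁ p₂ q₀ q₁ q₂ : Polynomial ℂ,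
      F - (Polynomial.aeval (X 2) p₀ + Polynomial.aeval (X 2) p₁ * X 0 +
          Polynomial.aeval (X 2) p₂ * X 0 ^ 2 +
          (Polynomial.aeval (X 2) q₀ + Polynomial.aeval (X 2) q₁ * X 0 +
          Polynomial.aeval (X 2) q₂ * X 0 ^ 2) * X 1) ∈
        Ideal.span {quadric R, cubic γ} := by
  simp only [Ideal.mem_span_pair]
  induction F using MvPolynomial.induction_on with
  | C a => exact ⟨Polynomial.C a, 0, 0, 0, 0, 0, 0, 0, by simp [MvPolynomial.algebraMap_eq]⟩
  | add p q hp hq =>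
    obtain ⟨p₀, p₁, p₂, q₀, q₁, q₂, f, g, h⟩ := hp
    obtain ⟨p₀', p₁', p₂', q₀', q₁', q₂', f', g', h'⟩ := hq
    refine ⟨p₀ + p₀', p₁ + p₁', p₂ + p₂', q₀ + q₀', q₁ + q₁', q₂ + q₂', f + f', g + g', ?_⟩
    simp only [map_add]
    linear_combination h + h'
  | mul_X p i hp =>
    obtain ⟨p₀, p₁, p₂, q₀, q₁, q₂, f, g, h⟩ := hp
    have h4 : (C (1 / 4) : MvPolynomial (Fin 3) ℂ) * 4 = 1 := by
      rw [show (4 : MvPolynomial (Fin 3) ℂ) = C 4 from (map_ofNat C 4).symm, ← C_mul]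
      norm_num
    have h3 : (C (3 / 4) : MvPolynomial (Fin 3) ℂ) = 3 * C (1 / 4) := by
      rw [show (3 : MvPolynomial (Fin 3) ℂ) = C 3 from (map_ofNat C 3).symm, ← C_mul]
      norm_num
    fin_cases i
    · let s : Polynomial ℂ := Polynomial.C (R * (3 / 4)) * Polynomial.X ^ 2
      let u : Polynomial ℂ := Polynomial.C (γ * (1 / 4)) * Polynomial.X ^ 3
      have hs : Polynomial.aeval (X 2 : MvPolynomial (Fin 3) ℂ) s =
          3 * C R * C (1 / 4) * X 2 ^ 2 := by
        simp only [s, map_mul, Polynomial.aeval_C, MvPolynomial.algebraMap_eq, map_pow,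
          Polynomial.aeval_X, h3]
        ring
      have hu : Polynomial.aeval (X 2 : MvPolynomial (Fin 3) ℂ) u =
          C γ * C (1 / 4) * X 2 ^ 3 := by
        simp only [u, map_mul, Polynomial.aeval_C, MvPolynomial.algebraMap_eq, map_pow,
          Polynomial.aeval_X]
      refine ⟨p₂ * u, p₀ + p₂ * s, p₁, q₂ * u, q₀ + q₂ * s, q₁,
        f * X 0 + C (1 / 4) * 3 * X 0 * (Polynomial.aeval (X 2) p₂ +
          Polynomial.aeval (X 2) q₂ * X 1),
        g * X 0 + C (1 / 4) * (Polynomial.aeval (X 2) p₂ +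
          Polynomial.aeval (X 2) q₂ * X 1), ?_⟩
      simp only [map_add, map_mul, hs, hu, Fin.zero_eta]
      simp only [quadric, cubic] at h ⊢
      linear_combination X 0 * h + X 0 ^ 3 * (Polynomial.aeval (X 2) p₂ +
          Polynomial.aeval (X 2) q₂ * X 1) * h4
    · let s : Polynomial ℂ := Polynomial.C R * Polynomial.X ^ 2
      let s' : Polynomial ℂ := Polynomial.C (R * (1 / 4)) * Polynomial.X ^ 2
      let u : Polynomial ℂ := Polynomial.C (γ * (1 / 4)) * Polynomial.X ^ 3
      have hs : Polynomial.aeval (X 2 : MvPolynomial (Fin 3) ℂ) s = C R * X 2 ^ 2 := by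
        simp only [s, map_mul, Polynomial.aeval_C, MvPolynomial.algebraMap_eq, map_pow,
          Polynomial.aeval_X]
      have hs' : Polynomial.aeval (X 2 : MvPolynomial (Fin 3) ℂ) s' =
          C R * C (1 / 4) * X 2 ^ 2 := by
        simp only [s', map_mul, Polynomial.aeval_C, MvPolynomial.algebraMap_eq, map_pow,
          Polynomial.aeval_X]
      have hu : Polynomial.aeval (X 2 : MvPolynomial (Fin 3) ℂ) u =
          C γ * C (1 / 4) * X 2 ^ 3 := by
        simp only [u, map_mul, Polynomial.aeval_C, MvPolynomial.algebraMap_eq, map_pow,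
          Polynomial.aeval_X]
      refine ⟨q₀ * s - q₁ * u, q₁ * s' - q₂ * u, q₂ * s' - q₀, p₀, p₁, p₂,
        f * X 1 + Polynomial.aeval (X 2) q₀ + (1 - 3 * C (1 / 4)) * X 0 *
          (Polynomial.aeval (X 2) q₁ + Polynomial.aeval (X 2) q₂ * X 0),
        g * X 1 - C (1 / 4) * (Polynomial.aeval (X 2) q₁ +
          Polynomial.aeval (X 2) q₂ * X 0), ?_⟩
      simp only [map_sub, map_mul, hs, hs', hu, Fin.mk_one]
      simp only [quadric, cubic] at h ⊢
      linear_combination X 1 * h - (X 0 ^ 3 - C R * X 2 ^ 2 * X 0) *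
          (Polynomial.aeval (X 2) q₁ + Polynomial.aeval (X 2) q₂ * X 0) * h4
    · refine ⟨p₀ * .X, p₁ * .X, p₂ * .X, q₀ * .X, q₁ * .X, q₂ * .X, f * X 2, g * X 2, ?_⟩
      simp only [map_mul, Polynomial.aeval_X, Fin.reduceFinMk]
      linear_combination X 2 * h

theorem eq_zero_of_eval_ofReal_eq_zero {p : Polynomial ℂ}
    (h : ∀ t : ℝ, t ≠ 0 → p.eval (t : ℂ) = 0) : p = 0 := by
  refine Polynomial.eq_zero_of_infinite_isRoot p (Set.Infinite.mono
    (s := (fun t : ℝ => (t : ℂ)) '' {0}ᶜ) ?_ ?_)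
  · rintro _ ⟨t, ht, rfl⟩
    exact h t ht
  · exact (Set.infinite_of_finite_compl (by simp)).image Complex.ofReal_injective.injOn

theorem Gorbit_invariants {v w : ℂ} (h : w ∈ Gorbit v) :
    w.re ^ 2 + w.im ^ 2 = v.re ^ 2 + v.im ^ 2 ∧
      w.re ^ 3 - 3 * w.re * w.im ^ 2 = v.re ^ 3 - 3 * v.re * v.im ^ 2 := by
  obtain ⟨g, hg, rfl⟩ := h
  have key : ∀ z : ℂ, (g z).re ^ 2 + (g z).im ^ 2 = z.re ^ 2 + z.im ^ 2 ∧
      (g z).re ^ 3 - 3 * (g z).re * (g z).im ^ 2 = z.re ^ 3 - 3 * z.re * z.im ^ 2 := by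
    induction hg using Subgroup.closure_induction with
    | mem x hx =>
      intro z
      rcases hx with rfl | rfl
      · have h1 : Complex.exp (2 * Real.pi * Complex.I / 3) ^ 3 = 1 := by
          rw [← Complex.exp_nat_mul, ← Complex.exp_two_pi_mul_I]
          congr 1
          push_cast
          ring
        have h2 : Complex.normSq (Complex.exp (2 * Real.pi * Complex.I / 3)) = 1 := by
          rw [Complex.normSq_eq_norm_sq, Complex.norm_eq_one_of_pow_eq_one h1 (by norm_num)]
          norm_num
        change ((Complex.exp _ * z).re ^ 2 + (Complex.exp _ * z).im ^ 2 = _) ∧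
          (Complex.exp _ * z).re ^ 3 - 3 * (Complex.exp _ * z).re * (Complex.exp _ * z).im ^ 2 = _
        generalize Complex.exp (2 * Real.pi * Complex.I / 3) = e at h1 h2
        have norm_eq (w : ℂ) : w.re ^ 2 + w.im ^ 2 = Complex.normSq w := by
          rw [Complex.normSq_apply]; ring
        have cube_eq (w : ℂ) : w.re ^ 3 - 3 * w.re * w.im ^ 2 = (w ^ 3).re := by
          simp [pow_succ]; ring
        simp only [norm_eq, cube_eq, mul_pow, h1, h2, map_mul, one_mul, and_self]
      · simp [conjPerm]
    | one => simp
    | mul x y _ _ hx hy =>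
      intro z
      exact ⟨(hx (y z)).1.trans (hy z).1, (hx (y z)).2.trans (hy z).2⟩
    | inv x _ hx =>
      intro z
      have := hx (x⁻¹ z)
      rw [show x (x⁻¹ z) = z from x.apply_symm_apply z] at this
      exact ⟨this.1.symm, this.2.symm⟩
  exact key v

/-- Six points on the intersection of a circle with a curve `x³ - 3xy² = γ` lie in pairs over
three distinct abscissae. -/
theorem exists_abscissae {S : Set ℂ} (hS : S.ncard = 6) {R γ : ℝ}
    (h : ∀ w ∈ S, w.re ^ 2 + w.im ^ 2 = R ∧ w.re ^ 3 - 3 * w.re * w.im ^ 2 = γ) :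
    ∃ a : Fin 3 → ℝ, Function.Injective a ∧
      ∀ i, ∃ w ∈ S, ∃ w' ∈ S, w.re = a i ∧ w'.re = a i ∧ w.im ≠ w'.im := by
  classical
  have hfin : S.Finite := Set.finite_of_ncard_pos (by omega)
  lift S to Finset ℂ using hfin
  rw [Set.ncard_coe_finset] at hS
  simp only [Finset.mem_coe] at h ⊢
  set T := S.image Complex.re
  have hsum : S.card = ∑ a ∈ T, {w ∈ S | w.re = a}.card :=
    Finset.card_eq_sum_card_image _ _
  have hfib : ∀ a ∈ T, {w ∈ S | w.re = a}.card ≤ 2 := by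
    intro a _
    by_contra! hc
    obtain ⟨x, y, z, hx, hy, hz, hxy, hxz, hyz⟩ := Finset.two_lt_card_iff.mp hc
    simp only [Finset.mem_filter] at hx hy hz
    have e (u v : ℂ) (hu : u ∈ S ∧ u.re = a) (hv : v ∈ S ∧ v.re = a) (huv : u ≠ v) :
        u.im = - v.im := by
      have h1 := (h u hu.1).1
      have h2 := (h v hv.1).1
      rw [hu.2] at h1
      rw [hv.2] at h2
      exact (sq_eq_sq_iff_eq_or_eq_neg.mp (by linarith)).resolve_left
        fun hi => huv (Complex.ext (hu.2.trans hv.2.symm) hi)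
    have h1 := e x y hx hy hxy
    have h2 := e x z hx hz hxz
    exact hyz (Complex.ext (hy.2.trans hz.2.symm) (by linarith))
  have hTle : T.card ≤ 3 := by
    let P : Polynomial ℝ := Polynomial.C 4 * Polynomial.X ^ 3 + Polynomial.C 0 * Polynomial.X ^ 2 +
      Polynomial.C (-(3 * R)) * Polynomial.X + Polynomial.C (-γ)
    have hP : P.natDegree = 3 := Polynomial.natDegree_cubic (by norm_num)
    have hP0 : P ≠ 0 := by
      intro h0
      simp [h0] at hP
    rw [← hP]
    refine (Finset.card_le_card (t := P.roots.toFinset) ?_).trans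
      ((Multiset.toFinset_card_le _).trans (Polynomial.card_roots' _))
    intro a ha
    obtain ⟨w, hw, rfl⟩ := Finset.mem_image.mp ha
    rw [Multiset.mem_toFinset, Polynomial.mem_roots hP0, Polynomial.IsRoot.def]
    simp only [P, Polynomial.eval_add, Polynomial.eval_mul, Polynomial.eval_C,
      Polynomial.eval_pow, Polynomial.eval_X]
    linear_combination 3 * w.re * (h w hw).1 + (h w hw).2
  have hT3 : T.card = 3 := by
    have := hsum.le.trans (Finset.sum_le_card_nsmul _ _ _ hfib)
    rw [smul_eq_mul] at this
    omega
  have hfib2 : ∀ a ∈ T, 1 < {w ∈ S | w.re = a}.card := by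
    intro a ha
    by_contra! hc
    have := Finset.sum_lt_sum hfib ⟨a, ha, by omega⟩
    rw [← hsum, Finset.sum_const, smul_eq_mul] at this
    omega
  let e := (T.equivFinOfCardEq hT3).symm
  refine ⟨fun i => e i, fun i j hij => e.injective (Subtype.ext hij), fun i => ?_⟩
  obtain ⟨w, hw, w', hw', hne⟩ := Finset.one_lt_card.mp (hfib2 (e i) (e i).2)
  simp only [Finset.mem_filter] at hw hw'
  exact ⟨w, hw.1, w', hw'.1, hw.2, hw'.2,
    fun hi => hne (Complex.ext (hw.2.trans hw'.2.symm) hi)⟩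

theorem quadratic_coeffs_eq_zero {a : Fin 3 → ℂ} (ha : Function.Injective a) {p q r : ℂ}
    (h : ∀ i, p + q * a i + r * a i ^ 2 = 0) : p = 0 ∧ q = 0 ∧ r = 0 := by
  have h01 : a 0 - a 1 ≠ 0 := sub_ne_zero.mpr (ha.ne (by decide))
  have h02 : a 0 - a 2 ≠ 0 := sub_ne_zero.mpr (ha.ne (by decide))
  have h12 : a 1 - a 2 ≠ 0 := sub_ne_zero.mpr (ha.ne (by decide))
  have e1 : q + r * (a 0 + a 1) = 0 :=
    mul_left_cancel₀ h01 (by linear_combination h 0 - h 1)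
  have e2 : q + r * (a 0 + a 2) = 0 :=
    mul_left_cancel₀ h02 (by linear_combination h 0 - h 2)
  have hr : r = 0 := mul_left_cancel₀ h12 (by linear_combination e1 - e2)
  have hq : q = 0 := by simpa [hr] using e1
  exact ⟨by simpa [hr, hq] using h 0, hq, hr⟩

theorem mem_span_of_vanishing {S : Set ℂ} (hS : S.ncard = 6) {R γ : ℝ}
    (hw : ∀ w ∈ S, w.re ^ 2 + w.im ^ 2 = R ∧ w.re ^ 3 - 3 * w.re * w.im ^ 2 = γ)
    {F : MvPolynomial (Fin 3) ℂ} :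
    (∀ w ∈ S, ∀ t : ℝ,
        eval (![((t * w.re : ℝ) : ℂ), ((t * w.im : ℝ) : ℂ), ((t : ℝ) : ℂ)]) F = 0) ↔
      F ∈ Ideal.span {quadric R, cubic γ} := by
  have hgen : ∀ G ∈ Ideal.span {quadric R, cubic γ}, ∀ w ∈ S, ∀ t : ℝ,
      eval (![((t * w.re : ℝ) : ℂ), ((t * w.im : ℝ) : ℂ), ((t : ℝ) : ℂ)]) G = 0 := by
    intro G hG w hwS t
    obtain ⟨f, g, rfl⟩ := Ideal.mem_span_pair.mp hG
    obtain ⟨h1, h2⟩ := hw w hwS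
    simp only [map_add, map_mul, eval_quadric, eval_cubic, ← h1, ← h2]
    simp
    ring
  refine ⟨fun hF => ?_, hgen F⟩
  obtain ⟨p₀, p₁, p₂, q₀, q₁, q₂, hN⟩ := exists_sub_mem_span_quadric_cubic (R : ℂ) γ F
  obtain ⟨a, ha, hpairs⟩ := exists_abscissae hS hw
  have hzero : ∀ t : ℝ, t ≠ 0 →
      (p₀.eval (t : ℂ) = 0 ∧ p₁.eval (t : ℂ) = 0 ∧ p₂.eval (t : ℂ) = 0) ∧
      (q₀.eval (t : ℂ) = 0 ∧ q₁.eval (t : ℂ) = 0 ∧ q₂.eval (t : ℂ) = 0) := by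
    intro t ht
    have htc : (t : ℂ) ≠ 0 := by exact_mod_cast ht
    have hval : ∀ w ∈ S,
        (p₀.eval (t : ℂ) + p₁.eval (t : ℂ) * (t * w.re) + p₂.eval (t : ℂ) * (t * w.re) ^ 2) +
        (q₀.eval (t : ℂ) + q₁.eval (t : ℂ) * (t * w.re) + q₂.eval (t : ℂ) * (t * w.re) ^ 2) *
          (t * w.im) = 0 := by
      intro w hwS
      have h0 := hgen _ hN w hwS t
      rw [map_sub, hF w hwS t] at h0
      simp only [map_add, map_mul, map_pow, eval_aeval_X, eval_X] at h0
      simpa [Matrix.cons_val] using neg_eq_zero.mp ((zero_sub _).symm.trans h0)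
    have hinj : Function.Injective fun i => (t * a i : ℂ) := by
      intro i j hij
      exact ha (Complex.ofReal_injective (mul_left_cancel₀ htc hij))
    have hq : ∀ i, q₀.eval (t : ℂ) + q₁.eval (t : ℂ) * (t * a i) +
        q₂.eval (t : ℂ) * (t * a i) ^ 2 = 0 := by
      intro i
      obtain ⟨w, hwS, w', hwS', h1, h2, hne⟩ := hpairs i
      have e1 := hval w hwS
      have e2 := hval w' hwS'
      rw [h1] at e1
      rw [h2] at e2
      have hd : (t : ℂ) * (w.im - w'.im) ≠ 0 :=
        mul_ne_zero htc (sub_ne_zero.mpr (by exact_mod_cast hne))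
      exact mul_right_cancel₀ hd (by linear_combination e1 - e2)
    refine ⟨quadratic_coeffs_eq_zero hinj fun i => ?_, quadratic_coeffs_eq_zero hinj hq⟩
    obtain ⟨w, hwS, -, -, h1, -, -⟩ := hpairs i
    have e1 := hval w hwS
    rw [h1, hq i] at e1
    simpa using e1
  have hp₀ := eq_zero_of_eval_ofReal_eq_zero fun t ht => (hzero t ht).1.1
  have hp₁ := eq_zero_of_eval_ofReal_eq_zero fun t ht => (hzero t ht).1.2.1
  have hp₂ := eq_zero_of_eval_ofReal_eq_zero fun t ht => (hzero t ht).1.2.2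
  have hq₀ := eq_zero_of_eval_ofReal_eq_zero fun t ht => (hzero t ht).2.1
  have hq₁ := eq_zero_of_eval_ofReal_eq_zero fun t ht => (hzero t ht).2.2.1
  have hq₂ := eq_zero_of_eval_ofReal_eq_zero fun t ht => (hzero t ht).2.2.2
  simpa [hp₀, hp₁, hp₂, hq₀, hq₁, hq₂] using hN

theorem quadric_ne_zero (R : ℂ) : quadric R ≠ 0 := by
  intro h
  have := eval_quadric R ![1, 0, 0]
  simp [h] at this

/-- The cubic is a non-zero-divisor modulo the quadric. -/
theorem mem_span_quadric_of_cubic_mul_mem (R γ : ℂ) {F : MvPolynomial (Fin 3) ℂ}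
    (h : cubic γ * F ∈ Ideal.span {quadric R}) : F ∈ Ideal.span {quadric R} := by
  obtain ⟨A, B, hAB⟩ := exists_sub_mem_span_quadric R F
  obtain ⟨g, hg⟩ := Ideal.mem_span_singleton'.mp h
  obtain ⟨k, hk⟩ := Ideal.mem_span_singleton'.mp hAB
  let D : MvPolynomial (Fin 2) ℂ := 4 * X 0 ^ 3 - 3 * C R * X 0 * X 1 ^ 2 - C γ * X 1 ^ 3
  let E : MvPolynomial (Fin 2) ℂ := C R * X 1 ^ 2 - X 0 ^ 2
  have hD0 : D ≠ 0 := by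
    intro h
    have := congrArg (eval ![1, 0]) h
    simp [D] at this
  have hE0 : E ≠ 0 := by
    intro h
    have := congrArg (eval ![1, 0]) h
    simp [E] at this
  have hpt : ∀ v : Fin 2 → ℂ, ∀ s : ℂ, s ^ 2 = eval v E →
      eval v D * (eval v A + eval v B * s) = 0 := by
    intro v s hs
    have e1 := congrArg (eval ![v 0, s, v 1]) hg
    have e2 := congrArg (eval ![v 0, s, v 1]) hk
    have hv : (![v 0, s, v 1] : Fin 3 → ℂ) ∘ ![0, 2] = v := by
      ext i; fin_cases i <;> rfl
    simp only [map_add, map_mul, map_sub, eval_quadric, eval_cubic, eval_rename, hv, eval_X,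
      Matrix.cons_val] at e1 e2
    simp only [D, E, map_sub, map_mul, map_pow, eval_C, eval_X, map_ofNat] at hs ⊢
    linear_combination -e1 + (eval ![v 0, s, v 1] g +
      3 * v 0 * (eval v A + eval v B * s)) * hs +
      (v 0 ^ 3 - 3 * v 0 * s ^ 2 - γ * v 1 ^ 3) * (e2 - eval ![v 0, s, v 1] k * hs)
  have hpm : ∀ v : Fin 2 → ℂ, eval v (D * A) = 0 ∧ eval v (D * (E * B)) = 0 := by
    intro v
    obtain ⟨s, hs⟩ := IsAlgClosed.exists_pow_nat_eq (eval v E) two_pos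
    have e1 := hpt v s hs
    have e2 := hpt v (-s) (by rw [neg_sq, hs])
    simp only [map_mul, ← hs]
    exact ⟨by linear_combination (e1 + e2) / 2, by linear_combination s * (e1 - e2) / 2⟩
  have hA : A = 0 := by
    have : D * A = 0 := MvPolynomial.funext fun v => by rw [(hpm v).1, map_zero]
    exact (mul_eq_zero.mp this).resolve_left hD0
  have hB : B = 0 := by
    have : D * (E * B) = 0 := MvPolynomial.funext fun v => by rw [(hpm v).2, map_zero]
    exact (mul_eq_zero.mp ((mul_eq_zero.mp this).resolve_left hD0)).resolve_left hE0
  simpa [hA, hB] using hAB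

open scoped Pointwise in
theorem isRegular_quadric_cubic (R γ : ℂ) :
    RingTheory.Sequence.IsRegular (MvPolynomial (Fin 3) ℂ) [quadric R, cubic γ] := by
  rw [RingTheory.Sequence.isRegular_iff, RingTheory.Sequence.isWeaklyRegular_cons_iff,
    RingTheory.Sequence.isWeaklyRegular_singleton_iff]
  refine ⟨⟨fun a b hab => mul_left_cancel₀ (quadric_ne_zero R) hab, ?_⟩, fun htop => ?_⟩
  · rw [isSMulRegular_quotient_iff_mem_of_smul_mem]
    have hmem (x : MvPolynomial (Fin 3) ℂ) :
        x ∈ quadric R • (⊤ : Submodule (MvPolynomial (Fin 3) ℂ) (MvPolynomial (Fin 3) ℂ)) ↔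
          x ∈ Ideal.span {quadric R} := by
      rw [← Submodule.ideal_span_singleton_smul, smul_eq_mul, Ideal.mul_top]
    intro F hF
    rw [hmem] at hF ⊢
    exact mem_span_quadric_of_cubic_mul_mem R γ hF
  · have h1 : (1 : MvPolynomial (Fin 3) ℂ) ∈ Ideal.span {quadric R, cubic γ} := by
      have : (1 : MvPolynomial (Fin 3) ℂ) ∈ Ideal.ofList [quadric R, cubic γ] •
          (⊤ : Submodule (MvPolynomial (Fin 3) ℂ) (MvPolynomial (Fin 3) ℂ)) :=
        htop ▸ Submodule.mem_top
      simpa [Ideal.ofList_cons, Ideal.span_insert] using this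
    obtain ⟨f, g, hfg⟩ := Ideal.mem_span_pair.mp h1
    have := congrArg (eval 0) hfg
    rw [map_add, map_mul, map_mul, eval_quadric, eval_cubic] at this
    simp at this

/-- The defining ideal of an orbit of size 6 is the complete intersection
generated by `x² + y² - r²z²` and `x³ - 3xy² - γz³`. Here a point `(a,b) ∈ ℝ²`
is identified with the complex number `a + b·i`. -/
theorem orbit_six_ideal (a₀ b₀ : ℝ)
    (h6 : (Gorbit (a₀ + b₀ * Complex.I)).ncard = 6) :
    {F : MvPolynomial (Fin 3) ℂ | ∀ w ∈ Gorbit (a₀ + b₀ * Complex.I), ∀ t : ℝ,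
        eval (![((t * w.re : ℝ) : ℂ), ((t * w.im : ℝ) : ℂ), ((t : ℝ) : ℂ)]) F = 0} =
      (Ideal.span
        {(X 0 ^ 2 + X 1 ^ 2 - C (((a₀ ^ 2 + b₀ ^ 2 : ℝ) : ℂ)) * X 2 ^ 2 :
            MvPolynomial (Fin 3) ℂ),
         (X 0 ^ 3 - 3 * X 0 * X 1 ^ 2 - C (((a₀ ^ 3 - 3 * a₀ * b₀ ^ 2 : ℝ) : ℂ)) * X 2 ^ 3 :
            MvPolynomial (Fin 3) ℂ)} : Set (MvPolynomial (Fin 3) ℂ)) ∧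
    RingTheory.Sequence.IsRegular (MvPolynomial (Fin 3) ℂ)
      [(X 0 ^ 2 + X 1 ^ 2 - C (((a₀ ^ 2 + b₀ ^ 2 : ℝ) : ℂ)) * X 2 ^ 2 :
          MvPolynomial (Fin 3) ℂ),
       (X 0 ^ 3 - 3 * X 0 * X 1 ^ 2 - C (((a₀ ^ 3 - 3 * a₀ * b₀ ^ 2 : ℝ) : ℂ)) * X 2 ^ 3 :
          MvPolynomial (Fin 3) ℂ)] := by
  refine ⟨?_, isRegular_quadric_cubic _ _⟩
  ext F
  refine mem_span_of_vanishing h6 fun w hw => ?_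
  simpa using Gorbit_invariants hw
end

section
/- Let n ≥ 3 be an integer divisible by 3, and consider the action of G on the set ℬ_n of triple points. The number of G-orbits in ℬ_n of cardinality 3 equals ⌊(n−1)/2⌋ − 1, and the number N₆ of G-orbits in ℬ_n of cardinality 6 satisfies 36·N₆ = n(n−3) − 18·⌊(n−1)/2⌋ + 18. -/
open Complex

/-- `P n j = exp(2πij/n)`. -/
noncomputable def Ppt (n j : ℕ) : ℂ := Complex.exp (2 * Real.pi * Complex.I * j / n)

/-- `Q n j = -exp(-4πij/n)`. -/
noncomputable def Qpt (n j : ℕ) : ℂ := -Complex.exp (-(4 * Real.pi * Complex.I * j) / n)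

open scoped Classical in
/-- The `j`-th line of the Böröczky configuration: the line through `P n j` and
`Q n j` if they are distinct, and the tangent line to the unit circle at `P n j`
otherwise (identifying ℝ² with ℂ). -/
noncomputable def Bline (n j : ℕ) : Set ℂ :=
  if Ppt n j = Qpt n j then
    {z : ℂ | (z * (starRingEnd ℂ) (Ppt n j)).re = 1}
  else
    {z : ℂ | ((z - Ppt n j) * (starRingEnd ℂ) (Qpt n j - Ppt n j)).im = 0}

/-- The set of triple points of the Böröczky configuration: points lying on at
least three of the lines `L_0, …, L_{n-1}`. -/
def TriplePts (n : ℕ) : Set ℂ :=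
  {z : ℂ | 3 ≤ ({j : ℕ | j < n ∧ z ∈ Bline n j} : Set ℕ).ncard}

open Polynomial (nthRootsFinset)

/-- The `n`-th roots of unity `a` such that `z` lies on the line of the configuration
through `a`. -/
noncomputable def cubicRoots (n : ℕ) (z : ℂ) : Finset ℂ :=
  (nthRootsFinset n (1 : ℂ)).filter
    fun a => a ^ 3 - z * a ^ 2 + (starRingEnd ℂ) z * a - 1 = 0

theorem mem_nthRootsFinset_one {n : ℕ} (hn : 0 < n) {a : ℂ} :
    a ∈ nthRootsFinset n (1 : ℂ) ↔ a ^ n = 1 :=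
  Polynomial.mem_nthRootsFinset hn 1

theorem mem_cubicRoots {n : ℕ} (hn : 0 < n) {z a : ℂ} :
    a ∈ cubicRoots n z ↔ a ^ n = 1 ∧ a ^ 3 - z * a ^ 2 + (starRingEnd ℂ) z * a - 1 = 0 := by
  rw [cubicRoots, Finset.mem_filter, mem_nthRootsFinset_one hn]

theorem ne_zero_of_pow_eq_one {n : ℕ} (hn : 0 < n) {a : ℂ} (ha : a ^ n = 1) : a ≠ 0 := by
  rintro rfl
  simp [hn.ne'] at ha

theorem conj_eq_inv_of_pow_eq_one {n : ℕ} (hn : 0 < n) {a : ℂ} (ha : a ^ n = 1) :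
    (starRingEnd ℂ) a = a⁻¹ :=
  (Complex.inv_eq_conj (Complex.norm_eq_one_of_pow_eq_one ha hn.ne')).symm

theorem Ppt_eq_pow (n j : ℕ) : Ppt n j = Complex.exp (2 * Real.pi * Complex.I / n) ^ j := by
  rw [Ppt, ← Complex.exp_nat_mul]
  congr 1
  ring

theorem Ppt_pow {n : ℕ} (hn : 0 < n) (j : ℕ) : Ppt n j ^ n = 1 := by
  rw [Ppt_eq_pow, ← pow_mul, mul_comm j n, pow_mul,
    (Complex.isPrimitiveRoot_exp n hn.ne').pow_eq_one, one_pow]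

theorem Qpt_eq (n j : ℕ) : Qpt n j = -(Ppt n j ^ 2)⁻¹ := by
  rw [Qpt, Ppt, ← Complex.exp_nat_mul, ← Complex.exp_neg]
  congr 2
  push_cast
  ring

theorem mem_Bline_iff {n : ℕ} (hn : 0 < n) (j : ℕ) (z : ℂ) :
    z ∈ Bline n j ↔
      Ppt n j ^ 3 - z * Ppt n j ^ 2 + (starRingEnd ℂ) z * Ppt n j - 1 = 0 := by
  have h1 := Ppt_pow hn j
  have hc := conj_eq_inv_of_pow_eq_one hn h1
  have h0 := ne_zero_of_pow_eq_one hn h1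
  rw [Bline, Qpt_eq]
  generalize Ppt n j = a at *
  split_ifs with h
  · have ha : a ^ 3 = -1 := by
      field_simp at h
      linear_combination h
    have hai : a⁻¹ = -a ^ 2 := by
      field_simp
      linear_combination ha
    have key : (((z * (starRingEnd ℂ) a).re : ℝ) : ℂ) = 1 ↔
        a ^ 3 - z * a ^ 2 + (starRingEnd ℂ) z * a - 1 = 0 := by
      rw [Complex.re_eq_add_conj, map_mul, Complex.conj_conj, hc, hai]
      constructor <;> intro h
      · linear_combination 2 * h + ha
      · linear_combination (h - ha) / 2
    rw [Set.mem_ofPred_eq, ← key]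
    exact_mod_cast Iff.rfl
  · have ha : a ^ 3 + 1 ≠ 0 := by
      intro h'
      apply h
      field_simp
      linear_combination h'
    rw [Set.mem_ofPred_eq, ← Complex.conj_eq_iff_im]
    simp only [map_mul, map_sub, map_neg, map_inv₀, map_pow, hc]
    field_simp
    constructor <;> intro h
    · have : (a ^ 3 + 1) * (a ^ 3 - z * a ^ 2 + (starRingEnd ℂ) z * a - 1) = 0 := by
        linear_combination -h
      linear_combination (mul_eq_zero.mp this).resolve_left ha
    · linear_combination -(a ^ 3 + 1) * h

theorem mem_TriplePts_iff {n : ℕ} (hn : 0 < n) (z : ℂ) :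
    z ∈ TriplePts n ↔ 3 ≤ (cubicRoots n z).card := by
  have hp := Complex.isPrimitiveRoot_exp n hn.ne'
  have himg : Ppt n '' {j : ℕ | j < n ∧ z ∈ Bline n j} = (cubicRoots n z : Set ℂ) := by
    ext a
    simp only [Set.mem_image, Set.mem_ofPred_eq, Finset.mem_coe, mem_cubicRoots hn,
      mem_Bline_iff hn]
    constructor
    · rintro ⟨j, ⟨-, hj⟩, rfl⟩
      exact ⟨Ppt_pow hn j, hj⟩
    · rintro ⟨ha, h⟩
      have : NeZero n := ⟨hn.ne'⟩
      obtain ⟨i, hi, rfl⟩ := hp.eq_pow_of_pow_eq_one ha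
      rw [← Ppt_eq_pow] at h ⊢
      exact ⟨i, ⟨hi, h⟩, rfl⟩
  have hinj : Set.InjOn (Ppt n) {j : ℕ | j < n ∧ z ∈ Bline n j} := by
    rintro i ⟨hi, -⟩ j ⟨hj, -⟩ h
    rw [Ppt_eq_pow, Ppt_eq_pow] at h
    exact hp.pow_inj hi hj h
  rw [TriplePts, Set.mem_ofPred_eq, ← hinj.ncard_image, himg, Set.ncard_coe_finset]

theorem eq_of_mem_cubicRoots {n : ℕ} (hn : 0 < n) {z a b : ℂ} (ha : a ∈ cubicRoots n z)
    (hb : b ∈ cubicRoots n z) (hab : a ≠ b) : z = a + b + (a * b)⁻¹ := by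
  rw [mem_cubicRoots hn] at ha hb
  have ha0 := ne_zero_of_pow_eq_one hn ha.1
  have hb0 := ne_zero_of_pow_eq_one hn hb.1
  have : (a - b) * (z * (a * b) - ((a + b) * (a * b) + 1)) = 0 := by
    linear_combination a * hb.2 - b * ha.2
  have := (mul_eq_zero.mp this).resolve_left (sub_ne_zero.mpr hab)
  field_simp
  linear_combination this

theorem mul_eq_one_of_mem_cubicRoots {n : ℕ} (hn : 0 < n) {z a b c : ℂ}
    (ha : a ∈ cubicRoots n z) (hb : b ∈ cubicRoots n z) (hc : c ∈ cubicRoots n z)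
    (hab : a ≠ b) (hac : a ≠ c) (hbc : b ≠ c) : a * b * c = 1 := by
  have h1 := eq_of_mem_cubicRoots hn ha hb hab
  have h2 := eq_of_mem_cubicRoots hn ha hc hac
  rw [mem_cubicRoots hn] at ha hb hc
  have ha0 := ne_zero_of_pow_eq_one hn ha.1
  have hb0 := ne_zero_of_pow_eq_one hn hb.1
  have hc0 := ne_zero_of_pow_eq_one hn hc.1
  rw [h1] at h2
  field_simp at h2
  have : (b - c) * (a * b * c - 1) = 0 := by linear_combination h2
  linear_combination (mul_eq_zero.mp this).resolve_left (sub_ne_zero.mpr hbc)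

theorem mem_cubicRoots_add {n : ℕ} (hn : 0 < n) {a b c : ℂ} (ha : a ^ n = 1) (hb : b ^ n = 1)
    (hc : c ^ n = 1) (h : a * b * c = 1) : a ∈ cubicRoots n (a + b + c) := by
  rw [mem_cubicRoots hn]
  refine ⟨ha, ?_⟩
  have ha0 := ne_zero_of_pow_eq_one hn ha
  have hb0 := ne_zero_of_pow_eq_one hn hb
  have hc0 := ne_zero_of_pow_eq_one hn hc
  simp only [map_add, conj_eq_inv_of_pow_eq_one hn ha, conj_eq_inv_of_pow_eq_one hn hb,
    conj_eq_inv_of_pow_eq_one hn hc]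
  field_simp
  linear_combination (-a * b - a * c) * h

theorem mem_TriplePts_iff_exists {n : ℕ} (hn : 0 < n) (z : ℂ) :
    z ∈ TriplePts n ↔ ∃ a b c : ℂ, a ^ n = 1 ∧ b ^ n = 1 ∧ c ^ n = 1 ∧ a ≠ b ∧ a ≠ c ∧ b ≠ c ∧
      a * b * c = 1 ∧ z = a + b + c := by
  rw [mem_TriplePts_iff hn]
  constructor
  · intro h
    obtain ⟨a, b, c, ha, hb, hc, hab, hac, hbc⟩ := Finset.two_lt_card_iff.mp h
    have h1 := mul_eq_one_of_mem_cubicRoots hn ha hb hc hab hac hbc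
    refine ⟨a, b, c, ((mem_cubicRoots hn).mp ha).1, ((mem_cubicRoots hn).mp hb).1,
      ((mem_cubicRoots hn).mp hc).1, hab, hac, hbc, h1, ?_⟩
    rw [eq_of_mem_cubicRoots hn ha hb hab, inv_eq_of_mul_eq_one_right h1]
  · rintro ⟨a, b, c, ha, hb, hc, hab, hac, hbc, h, rfl⟩
    refine Finset.two_lt_card_iff.mpr ⟨a, b, c, mem_cubicRoots_add hn ha hb hc h, ?_, ?_,
      hab, hac, hbc⟩
    · rw [add_comm a b]
      exact mem_cubicRoots_add hn hb ha hc (by linear_combination h)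
    · rw [show a + b + c = c + a + b by ring]
      exact mem_cubicRoots_add hn hc ha hb (by linear_combination h)

theorem card_cubicRoots {n : ℕ} (hn : 0 < n) {z : ℂ} (hz : z ∈ TriplePts n) :
    (cubicRoots n z).card = 3 := by
  obtain ⟨a, b, c, ha, hb, hc, hab, hac, hbc⟩ :=
    Finset.two_lt_card_iff.mp ((mem_TriplePts_iff hn z).mp hz)
  refine Finset.card_eq_three.mpr ⟨a, b, c, hab, hac, hbc, ?_⟩
  ext d
  simp only [Finset.mem_insert, Finset.mem_singleton]
  constructor
  · intro hd
    by_contra! hne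
    have h1 := mul_eq_one_of_mem_cubicRoots hn ha hb hc hab hac hbc
    have h2 := mul_eq_one_of_mem_cubicRoots hn ha hb hd hab hne.1.symm hne.2.1.symm
    exact hne.2.2 (mul_left_cancel₀ (left_ne_zero_of_mul_eq_one h1) (h2.trans h1.symm))
  · rintro (rfl | rfl | rfl) <;> assumption

/-- The pairs of distinct `n`-th roots of unity `a`, `b` such that `(ab)⁻¹` differs from both. -/
noncomputable def triplePairs (n : ℕ) : Finset (ℂ × ℂ) :=
  (nthRootsFinset n (1 : ℂ) ×ˢ nthRootsFinset n (1 : ℂ)).filter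
    fun p => p.1 ≠ p.2 ∧ p.1 ^ 2 * p.2 ≠ 1 ∧ p.1 * p.2 ^ 2 ≠ 1

theorem mem_triplePairs {n : ℕ} (hn : 0 < n) {p : ℂ × ℂ} : p ∈ triplePairs n ↔
    (p.1 ^ n = 1 ∧ p.2 ^ n = 1) ∧ p.1 ≠ p.2 ∧ p.1 ^ 2 * p.2 ≠ 1 ∧ p.1 * p.2 ^ 2 ≠ 1 := by
  rw [triplePairs, Finset.mem_filter, Finset.mem_product, mem_nthRootsFinset_one hn,
    mem_nthRootsFinset_one hn]

theorem TriplePts_eq_image {n : ℕ} (hn : 0 < n) :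
    TriplePts n = ((triplePairs n).image fun p => p.1 + p.2 + (p.1 * p.2)⁻¹ : Finset ℂ) := by
  ext z
  simp only [Finset.coe_image, Set.mem_image, Finset.mem_coe, mem_triplePairs hn,
    mem_TriplePts_iff_exists hn, Prod.exists]
  constructor
  · rintro ⟨a, b, c, ha, hb, -, hab, hac, hbc, h, rfl⟩
    have h0 := left_ne_zero_of_mul_eq_one h
    refine ⟨a, b, ⟨⟨ha, hb⟩, hab, fun h' => hac ?_, fun h' => hbc ?_⟩, ?_⟩
    · exact mul_left_cancel₀ h0 (by linear_combination h' - h)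
    · exact mul_left_cancel₀ h0 (by linear_combination h' - h)
    · rw [inv_eq_of_mul_eq_one_right h]
  · rintro ⟨a, b, ⟨⟨ha, hb⟩, hab, h1, h2⟩, rfl⟩
    have ha0 := ne_zero_of_pow_eq_one hn ha
    have hb0 := ne_zero_of_pow_eq_one hn hb
    refine ⟨a, b, (a * b)⁻¹, ha, hb, by rw [inv_pow, mul_pow, ha, hb]; simp, hab, ?_, ?_, ?_, rfl⟩
    · intro h
      have h' := mul_inv_cancel₀ (mul_ne_zero ha0 hb0)
      rw [← h] at h'
      exact h1 (by linear_combination h')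
    · intro h
      have h' := mul_inv_cancel₀ (mul_ne_zero ha0 hb0)
      rw [← h] at h'
      exact h2 (by linear_combination h')
    · field_simp

theorem card_triplePairs {n : ℕ} (hn : 0 < n) (hdvd : 3 ∣ n) :
    (triplePairs n).card + 3 * n = n ^ 2 + 6 := by
  set R := nthRootsFinset n (1 : ℂ) with hR
  set C := nthRootsFinset 3 (1 : ℂ) with hC
  have hRcard : R.card = n := (Complex.isPrimitiveRoot_exp n hn.ne').card_nthRootsFinset
  have hCcard : C.card = 3 := (Complex.isPrimitiveRoot_exp 3 three_ne_zero).card_nthRootsFinset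
  have hmR : ∀ a, a ∈ R ↔ a ^ n = 1 := fun a => mem_nthRootsFinset_one hn
  have hmC : ∀ a, a ∈ C ↔ a ^ 3 = 1 := fun a => mem_nthRootsFinset_one three_pos
  have hCR : C ⊆ R := by
    intro a ha
    rw [hmC] at ha
    obtain ⟨k, rfl⟩ := hdvd
    rw [hmR, pow_mul, ha, one_pow]
  have hdiff : (R \ C).card + 3 = n := by
    rw [← hCcard, Finset.card_sdiff_add_card_eq_card hCR, hRcard]
  let D₀ := R.image fun a => (a, a)
  let D₁ := (R \ C).image fun a => (a, (a ^ 2)⁻¹)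
  let D₂ := (R \ C).image fun a => ((a ^ 2)⁻¹, a)
  have h0 : D₀.card = n := by
    rw [Finset.card_image_of_injective _ (fun a b h => (Prod.ext_iff.mp h).1), hRcard]
  have h1 : D₁.card = (R \ C).card :=
    Finset.card_image_of_injective _ (fun a b h => (Prod.ext_iff.mp h).1)
  have h2 : D₂.card = (R \ C).card :=
    Finset.card_image_of_injective _ (fun a b h => (Prod.ext_iff.mp h).2)
  have hne : ∀ a ∈ R, a ≠ 0 := fun a ha => ne_zero_of_pow_eq_one hn ((hmR a).mp ha)
  have m0 : ∀ a b, (a, b) ∈ D₀ ↔ a ∈ R ∧ a = b := by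
    intro a b
    simp only [D₀, Finset.mem_image, Prod.mk.injEq]
    constructor
    · rintro ⟨c, hc, rfl, rfl⟩
      exact ⟨hc, rfl⟩
    · rintro ⟨hc, rfl⟩
      exact ⟨a, hc, rfl, rfl⟩
  have hRinv : ∀ a ∈ R, (a ^ 2)⁻¹ ∈ R := by
    intro a ha
    rw [hmR] at ha ⊢
    rw [inv_pow, ← pow_mul, mul_comm, pow_mul, ha, one_pow, inv_one]
  have m1 : ∀ a b, (a, b) ∈ D₁ ↔ a ∈ R ∧ b ∈ R ∧ a ^ 3 ≠ 1 ∧ a ^ 2 * b = 1 := by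
    intro a b
    simp only [D₁, Finset.mem_image, Prod.mk.injEq, Finset.mem_sdiff, hmC]
    constructor
    · rintro ⟨c, ⟨hc, hc3⟩, rfl, rfl⟩
      exact ⟨hc, hRinv c hc, hc3, mul_inv_cancel₀ (pow_ne_zero 2 (hne c hc))⟩
    · rintro ⟨ha, -, h3, h⟩
      exact ⟨a, ⟨ha, h3⟩, rfl, inv_eq_of_mul_eq_one_right h⟩
  have m2 : ∀ a b, (a, b) ∈ D₂ ↔ a ∈ R ∧ b ∈ R ∧ b ^ 3 ≠ 1 ∧ a * b ^ 2 = 1 := by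
    intro a b
    simp only [D₂, Finset.mem_image, Prod.mk.injEq, Finset.mem_sdiff, hmC]
    constructor
    · rintro ⟨c, ⟨hc, hc3⟩, rfl, rfl⟩
      exact ⟨hRinv c hc, hc, hc3, inv_mul_cancel₀ (pow_ne_zero 2 (hne c hc))⟩
    · rintro ⟨-, ha, h3, h⟩
      exact ⟨b, ⟨ha, h3⟩, inv_eq_of_mul_eq_one_left h, rfl⟩
  have d01 : Disjoint D₀ D₁ := by
    rw [Finset.disjoint_left]
    rintro ⟨a, b⟩ h h'
    rw [m0] at h
    rw [m1] at h'
    obtain ⟨-, rfl⟩ := h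
    exact h'.2.2.1 (by linear_combination h'.2.2.2)
  have d012 : Disjoint (D₀ ∪ D₁) D₂ := by
    rw [Finset.disjoint_left]
    rintro ⟨a, b⟩ h h'
    rw [Finset.mem_union, m0, m1] at h
    rw [m2] at h'
    obtain ⟨ha, hb, h3, h2⟩ := h'
    rcases h with ⟨-, rfl⟩ | ⟨-, -, h3', h1⟩
    · exact h3 (by linear_combination h2)
    · have : a = b := by
        refine mul_left_cancel₀ (mul_ne_zero (hne a ha) (hne b hb)) ?_
        linear_combination h1 - h2
      subst this
      exact h3 (by linear_combination h2)
  have hsub : D₀ ∪ D₁ ∪ D₂ ⊆ R ×ˢ R := by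
    rintro ⟨a, b⟩ h
    rw [Finset.mem_union, Finset.mem_union, m0, m1, m2] at h
    rw [Finset.mem_product]
    rcases h with (⟨h, rfl⟩ | ⟨h, h', -⟩) | ⟨h, h', -⟩
    exacts [⟨h, h⟩, ⟨h, h'⟩, ⟨h, h'⟩]
  have heq : triplePairs n = (R ×ˢ R) \ (D₀ ∪ D₁ ∪ D₂) := by
    ext ⟨a, b⟩
    rw [triplePairs, Finset.mem_filter, Finset.mem_sdiff, Finset.mem_union, Finset.mem_union,
      m0, m1, m2, ← hR, Finset.mem_product]
    refine and_congr_right ?_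
    rintro ⟨ha, hb⟩
    dsimp only at ha hb ⊢
    simp only [ha, hb, true_and]
    constructor
    · rintro ⟨h, h1, h2⟩
      tauto
    · intro h
      push Not at h
      obtain ⟨⟨hab, h1⟩, h2⟩ := h
      refine ⟨hab, fun h' => ?_, fun h' => ?_⟩
      · by_cases h3 : a ^ 3 = 1
        · exact hab (mul_left_cancel₀ (pow_ne_zero 2 (hne a ha))
            (by linear_combination h3 - h'))
        · exact h1 h3 h'
      · by_cases h3 : b ^ 3 = 1
        · exact hab (mul_right_cancel₀ (pow_ne_zero 2 (hne b hb))
            (by linear_combination h' - h3))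
        · exact h2 h3 h'
  have hcard := Finset.card_sdiff_add_card_eq_card hsub
  rw [← heq, Finset.card_union_of_disjoint d012, Finset.card_union_of_disjoint d01, h0, h1, h2,
    Finset.card_product, hRcard] at hcard
  rw [sq, ← hcard]
  omega

theorem finite_TriplePts {n : ℕ} (hn : 0 < n) : (TriplePts n).Finite := by
  rw [TriplePts_eq_image hn]
  exact Finset.finite_toSet _

theorem six_mul_ncard_TriplePts {n : ℕ} (hn : 0 < n) (hdvd : 3 ∣ n) :
    6 * (TriplePts n).ncard + 3 * n = n ^ 2 + 6 := by
  rw [← card_triplePairs hn hdvd, Finset.card_eq_sum_card_image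
    (fun p : ℂ × ℂ => p.1 + p.2 + (p.1 * p.2)⁻¹) (triplePairs n)]
  congr 1
  rw [Finset.sum_const_nat (m := 6), TriplePts_eq_image hn, Set.ncard_coe_finset, mul_comm]
  intro z hz
  have hz' : z ∈ TriplePts n := by
    rw [TriplePts_eq_image hn]
    exact hz
  have : (triplePairs n).filter (fun p => p.1 + p.2 + (p.1 * p.2)⁻¹ = z) =
      (cubicRoots n z).offDiag := by
    ext ⟨a, b⟩
    rw [Finset.mem_filter, mem_triplePairs hn, Finset.mem_offDiag]
    dsimp only
    constructor
    · rintro ⟨⟨⟨ha, hb⟩, hab, -, -⟩, rfl⟩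
      have ha0 := ne_zero_of_pow_eq_one hn ha
      have hb0 := ne_zero_of_pow_eq_one hn hb
      have hc : (a * b)⁻¹ ^ n = 1 := by rw [inv_pow, mul_pow, ha, hb]; simp
      have h := mul_inv_cancel₀ (mul_ne_zero ha0 hb0)
      refine ⟨mem_cubicRoots_add hn ha hb hc h, ?_, hab⟩
      have := mem_cubicRoots_add hn hb ha hc (by linear_combination h)
      rwa [add_comm b a] at this
    · rintro ⟨ha, hb, hab⟩
      have hz3 := card_cubicRoots hn hz'
      obtain ⟨c, hc, hca, hcb⟩ : ∃ c ∈ cubicRoots n z, c ≠ a ∧ c ≠ b := by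
        have h2 : ({a, b} : Finset ℂ).card < (cubicRoots n z).card := by
          rw [hz3, Finset.card_pair hab]
          norm_num
        obtain ⟨c, hc, hc'⟩ := Finset.exists_mem_notMem_of_card_lt_card h2
        simp only [Finset.mem_insert, Finset.mem_singleton, not_or] at hc'
        exact ⟨c, hc, hc'⟩
      have h := mul_eq_one_of_mem_cubicRoots hn ha hb hc hab hca.symm hcb.symm
      have h0 : a * b ≠ 0 := left_ne_zero_of_mul_eq_one h
      refine ⟨⟨⟨((mem_cubicRoots hn).mp ha).1, ((mem_cubicRoots hn).mp hb).1⟩, hab, ?_, ?_⟩,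
        (eq_of_mem_cubicRoots hn ha hb hab).symm⟩
      · exact fun h' => hca (mul_left_cancel₀ h0 (by linear_combination h - h'))
      · exact fun h' => hcb (mul_left_cancel₀ h0 (by linear_combination h - h'))
  rw [this, Finset.offDiag_card, card_cubicRoots hn hz']

/-- The primitive cube root of unity `exp(2πi/3)`. -/
noncomputable def cubeRoot : ℂ := Complex.exp (2 * Real.pi * Complex.I / 3)

theorem isPrimitiveRoot_cubeRoot : IsPrimitiveRoot cubeRoot 3 := by
  simpa [cubeRoot] using Complex.isPrimitiveRoot_exp 3 three_ne_zero

theorem cubeRoot_pow_three : cubeRoot ^ 3 = 1 := isPrimitiveRoot_cubeRoot.pow_eq_one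

theorem cubeRoot_ne_one : cubeRoot ≠ 1 :=
  isPrimitiveRoot_cubeRoot.ne_one (by norm_num)

theorem cubeRoot_sq : cubeRoot ^ 2 = -1 - cubeRoot := by
  have h : (cubeRoot - 1) * (cubeRoot ^ 2 + cubeRoot + 1) = 0 := by
    linear_combination cubeRoot_pow_three
  linear_combination (mul_eq_zero.mp h).resolve_left (sub_ne_zero.mpr cubeRoot_ne_one)

theorem eq_of_pow_three_eq_one {w : ℂ} (h : w ^ 3 = 1) :
    w = 1 ∨ w = cubeRoot ∨ w = cubeRoot ^ 2 := by
  obtain ⟨i, hi, rfl⟩ := isPrimitiveRoot_cubeRoot.eq_pow_of_pow_eq_one h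
  interval_cases i <;> simp

theorem exists_of_mem_dihedralG {g : Equiv.Perm ℂ} (hg : g ∈ dihedralG) :
    ∃ w : ℂ, w ^ 3 = 1 ∧ ((∀ z, g z = w * z) ∨ ∀ z, g z = w * (starRingEnd ℂ) z) := by
  induction hg using Subgroup.closure_induction with
  | mem x hx =>
    rcases hx with rfl | rfl
    · exact ⟨cubeRoot, cubeRoot_pow_three, Or.inl fun z => rfl⟩
    · exact ⟨1, one_pow 3, Or.inr fun z => (one_mul _).symm⟩
  | one => exact ⟨1, one_pow 3, Or.inl fun z => (one_mul _).symm⟩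
  | mul x y _ _ hx hy =>
    obtain ⟨v, hv, hx⟩ := hx
    obtain ⟨w, hw, hy⟩ := hy
    have hw' : (starRingEnd ℂ) w ^ 3 = 1 := by rw [← map_pow, hw, map_one]
    rcases hx with hx | hx
    · refine ⟨v * w, by rw [mul_pow, hv, hw, one_mul], ?_⟩
      rcases hy with hy | hy
      · exact Or.inl fun z => by rw [Equiv.Perm.mul_apply, hy, hx, mul_assoc]
      · exact Or.inr fun z => by rw [Equiv.Perm.mul_apply, hy, hx, mul_assoc]
    · refine ⟨v * (starRingEnd ℂ) w, by rw [mul_pow, hv, hw', one_mul], ?_⟩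
      rcases hy with hy | hy
      · exact Or.inr fun z => by rw [Equiv.Perm.mul_apply, hy, hx, map_mul, mul_assoc]
      · exact Or.inl fun z => by
          rw [Equiv.Perm.mul_apply, hy, hx, map_mul, Complex.conj_conj, mul_assoc]
  | inv x _ hx =>
    obtain ⟨w, hw, hx⟩ := hx
    have hw0 := ne_zero_of_pow_eq_one three_pos hw
    have hwc := conj_eq_inv_of_pow_eq_one three_pos hw
    rcases hx with hx | hx
    · refine ⟨w⁻¹, by rw [inv_pow, hw, inv_one], Or.inl fun z => ?_⟩
      rw [Equiv.Perm.inv_eq_iff_eq, hx, mul_inv_cancel_left₀ hw0]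
    · refine ⟨w, hw, Or.inr fun z => ?_⟩
      rw [Equiv.Perm.inv_eq_iff_eq, hx, map_mul, Complex.conj_conj, hwc, mul_inv_cancel_left₀ hw0]

theorem mem_Gorbit_iff {v z : ℂ} :
    z ∈ Gorbit v ↔ ∃ w : ℂ, w ^ 3 = 1 ∧ (z = w * v ∨ z = w * (starRingEnd ℂ) v) := by
  constructor
  · rintro ⟨g, hg, rfl⟩
    obtain ⟨w, hw, h⟩ := exists_of_mem_dihedralG hg
    exact ⟨w, hw, h.imp (fun h => h v) fun h => h v⟩
  · rintro ⟨w, hw, h⟩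
    have hr : rotPerm ∈ dihedralG := Subgroup.subset_closure (by simp)
    have hc : conjPerm ∈ dihedralG := Subgroup.subset_closure (by simp)
    obtain ⟨k, -, rfl⟩ := isPrimitiveRoot_cubeRoot.eq_pow_of_pow_eq_one hw
    have hk : ∀ u, (rotPerm ^ k) u = cubeRoot ^ k * u := by
      clear hw h
      intro u
      induction k with
      | zero => simp
      | succ k ih =>
        rw [pow_succ', Equiv.Perm.mul_apply, ih, pow_succ', mul_assoc]
        rfl
    rcases h with rfl | rfl
    · exact ⟨rotPerm ^ k, pow_mem hr k, hk v⟩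
    · exact ⟨rotPerm ^ k * conjPerm, mul_mem (pow_mem hr k) hc, hk _⟩

theorem Gorbit_eq_orbit (v : ℂ) : Gorbit v = MulAction.orbit dihedralG v := by
  ext z
  constructor
  · rintro ⟨g, hg, rfl⟩
    exact ⟨⟨g, hg⟩, rfl⟩
  · rintro ⟨⟨g, hg⟩, rfl⟩
    exact ⟨g, hg, rfl⟩

theorem Gorbit_eq_iff {u v : ℂ} : Gorbit u = Gorbit v ↔ u ∈ Gorbit v := by
  rw [Gorbit_eq_orbit, Gorbit_eq_orbit, MulAction.orbit_eq_iff]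

theorem mem_Gorbit_self (v : ℂ) : v ∈ Gorbit v := Gorbit_eq_iff.mp rfl

theorem Gorbit_zero : Gorbit 0 = {0} := by
  ext z
  rw [mem_Gorbit_iff]
  constructor
  · rintro ⟨w, -, h⟩
    simpa using h
  · rintro rfl
    exact ⟨1, one_pow 3, by simp⟩

theorem Gorbit_eq_insert (v : ℂ) : Gorbit v =
    {v, cubeRoot * v, cubeRoot ^ 2 * v, (starRingEnd ℂ) v, cubeRoot * (starRingEnd ℂ) v,
      cubeRoot ^ 2 * (starRingEnd ℂ) v} := by
  ext z
  rw [mem_Gorbit_iff]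
  simp only [Set.mem_insert_iff, Set.mem_singleton_iff]
  constructor
  · rintro ⟨w, hw, h⟩
    rcases eq_of_pow_three_eq_one hw with rfl | rfl | rfl
    · rw [one_mul, one_mul] at h
      tauto
    · tauto
    · tauto
  · have h1 : (1 : ℂ) ^ 3 = 1 := one_pow 3
    have h2 : (cubeRoot ^ 2) ^ 3 = 1 := by
      rw [← pow_mul, mul_comm, pow_mul, cubeRoot_pow_three, one_pow]
    rintro (h | h | h | h | h | h)
    · exact ⟨1, h1, Or.inl (by rw [h, one_mul])⟩
    · exact ⟨_, cubeRoot_pow_three, Or.inl h⟩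
    · exact ⟨_, h2, Or.inl h⟩
    · exact ⟨1, h1, Or.inr (by rw [h, one_mul])⟩
    · exact ⟨_, cubeRoot_pow_three, Or.inr h⟩
    · exact ⟨_, h2, Or.inr h⟩

theorem ncard_rotations {v : ℂ} (hv : v ≠ 0) :
    ({v, cubeRoot * v, cubeRoot ^ 2 * v} : Set ℂ).ncard = 3 := by
  have h0 : cubeRoot ≠ 0 := ne_zero_of_pow_eq_one three_pos cubeRoot_pow_three
  have h2 : cubeRoot ^ 2 ≠ 1 := isPrimitiveRoot_cubeRoot.pow_ne_one_of_pos_of_lt two_ne_zero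
    (by norm_num)
  have h3 : cubeRoot ^ 2 ≠ cubeRoot := fun h =>
    cubeRoot_ne_one (mul_left_cancel₀ h0 (by linear_combination h))
  rw [Set.ncard_eq_three]
  refine ⟨v, cubeRoot * v, cubeRoot ^ 2 * v, ?_, ?_, ?_, rfl⟩
  · exact fun h => cubeRoot_ne_one (mul_right_cancel₀ hv (by rw [one_mul]; exact h.symm))
  · exact fun h => h2 (mul_right_cancel₀ hv (by rw [one_mul]; exact h.symm))
  · exact fun h => h3 (mul_right_cancel₀ hv h.symm)

theorem ncard_Gorbit_of_real {v : ℂ} (hv : v ≠ 0) (h : (starRingEnd ℂ) v = v) :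
    (Gorbit v).ncard = 3 := by
  rw [← ncard_rotations hv, Gorbit_eq_insert, h]
  congr 1
  ext z
  simp only [Set.mem_insert_iff, Set.mem_singleton_iff]
  tauto

theorem ncard_Gorbit_of_forall_not_real {v : ℂ} (hv : v ≠ 0)
    (h : ∀ u ∈ Gorbit v, (starRingEnd ℂ) u ≠ u) : (Gorbit v).ncard = 6 := by
  have hv' : (starRingEnd ℂ) v ≠ 0 := by simpa using hv
  have heq : Gorbit v = {v, cubeRoot * v, cubeRoot ^ 2 * v} ∪
      {(starRingEnd ℂ) v, cubeRoot * (starRingEnd ℂ) v, cubeRoot ^ 2 * (starRingEnd ℂ) v} := by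
    rw [Gorbit_eq_insert]
    ext z
    simp only [Set.mem_insert_iff, Set.mem_singleton_iff, Set.mem_union]
    tauto
  have hkey : ∀ w : ℂ, w ^ 3 = 1 → (starRingEnd ℂ) v ≠ w * v := by
    intro w hw hwv
    have hw0 := ne_zero_of_pow_eq_one three_pos hw
    refine h (w ^ 2 * v) (mem_Gorbit_iff.mpr ⟨w ^ 2, ?_, Or.inl rfl⟩) ?_
    · rw [← pow_mul, mul_comm, pow_mul, hw, one_pow]
    · rw [map_mul, map_pow, conj_eq_inv_of_pow_eq_one three_pos hw, hwv]
      field_simp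
      linear_combination -hw
  have hdisj : Disjoint ({v, cubeRoot * v, cubeRoot ^ 2 * v} : Set ℂ)
      {(starRingEnd ℂ) v, cubeRoot * (starRingEnd ℂ) v, cubeRoot ^ 2 * (starRingEnd ℂ) v} := by
    have hform : ∀ x y : ℂ, y ∈ ({x, cubeRoot * x, cubeRoot ^ 2 * x} : Set ℂ) →
        ∃ w : ℂ, w ^ 3 = 1 ∧ y = w * x := by
      intro x y hy
      simp only [Set.mem_insert_iff, Set.mem_singleton_iff] at hy
      rcases hy with rfl | rfl | rfl
      · exact ⟨1, one_pow 3, (one_mul _).symm⟩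
      · exact ⟨_, cubeRoot_pow_three, rfl⟩
      · exact ⟨_, by rw [← pow_mul, mul_comm, pow_mul, cubeRoot_pow_three, one_pow], rfl⟩
    rw [Set.disjoint_left]
    intro z h1 h2
    obtain ⟨w, hw, rfl⟩ := hform _ _ h1
    obtain ⟨x, hx, h2⟩ := hform _ _ h2
    have hx0 := ne_zero_of_pow_eq_one three_pos hx
    refine hkey (w * x⁻¹) (by rw [mul_pow, inv_pow, hw, hx]; simp) ?_
    field_simp
    linear_combination -h2
  rw [heq, Set.ncard_union_eq hdisj (Set.toFinite _) (Set.toFinite _), ncard_rotations hv,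
    ncard_rotations hv']

theorem eq_of_real_of_mem_Gorbit {u v : ℂ} (hu : (starRingEnd ℂ) u = u)
    (hv : (starRingEnd ℂ) v = v) (h : u ∈ Gorbit v) : u = v := by
  rw [mem_Gorbit_iff, hv] at h
  obtain ⟨w, hw, h⟩ := h
  rw [or_self] at h
  subst h
  rcases eq_or_ne v 0 with rfl | hv0
  · rw [mul_zero]
  · rw [map_mul, hv] at hu
    have hw' := mul_right_cancel₀ hv0 hu
    rw [conj_eq_inv_of_pow_eq_one three_pos hw] at hw'
    have hww := mul_inv_cancel₀ (ne_zero_of_pow_eq_one three_pos hw)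
    rw [hw'] at hww
    have : w = 1 := by linear_combination hw - w * hww
    rw [this, one_mul]

theorem mem_TriplePts_of_mem_Gorbit {n : ℕ} (hn : 0 < n) (hdvd : 3 ∣ n) {u v : ℂ}
    (hv : v ∈ TriplePts n) (hu : u ∈ Gorbit v) : u ∈ TriplePts n := by
  have hmul : ∀ w z : ℂ, w ^ 3 = 1 → z ∈ TriplePts n → w * z ∈ TriplePts n := by
    intro w z hw hz
    rw [mem_TriplePts_iff_exists hn] at hz ⊢
    obtain ⟨a, b, c, ha, hb, hc, hab, hac, hbc, h, rfl⟩ := hz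
    have hw0 := ne_zero_of_pow_eq_one three_pos hw
    have hwn : w ^ n = 1 := by
      obtain ⟨k, rfl⟩ := hdvd
      rw [pow_mul, hw, one_pow]
    refine ⟨w * a, w * b, w * c, by rw [mul_pow, hwn, ha, one_mul],
      by rw [mul_pow, hwn, hb, one_mul], by rw [mul_pow, hwn, hc, one_mul],
      fun h => hab (mul_left_cancel₀ hw0 h), fun h => hac (mul_left_cancel₀ hw0 h),
      fun h => hbc (mul_left_cancel₀ hw0 h), by linear_combination w ^ 3 * h + hw, by ring⟩
  have hconj : (starRingEnd ℂ) v ∈ TriplePts n := by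
    rw [mem_TriplePts_iff_exists hn] at hv ⊢
    obtain ⟨a, b, c, ha, hb, hc, hab, hac, hbc, h, rfl⟩ := hv
    have hinj := (starRingEnd ℂ).injective
    exact ⟨_, _, _, by rw [← map_pow, ha, map_one], by rw [← map_pow, hb, map_one],
      by rw [← map_pow, hc, map_one], hinj.ne hab, hinj.ne hac, hinj.ne hbc,
      by rw [← map_mul, ← map_mul, h, map_one], by rw [map_add, map_add]⟩
  obtain ⟨w, hw, rfl | rfl⟩ := mem_Gorbit_iff.mp hu
  exacts [hmul w v hw hv, hmul w _ hw hconj]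

theorem zero_mem_TriplePts {n : ℕ} (hn : 0 < n) (hdvd : 3 ∣ n) : (0 : ℂ) ∈ TriplePts n := by
  have h3 := cubeRoot_pow_three
  have h0 : cubeRoot ≠ 0 := ne_zero_of_pow_eq_one three_pos h3
  have hpow : cubeRoot ^ n = 1 := by
    obtain ⟨k, rfl⟩ := hdvd
    rw [pow_mul, h3, one_pow]
  rw [mem_TriplePts_iff_exists hn]
  refine ⟨1, cubeRoot, cubeRoot ^ 2, one_pow n, hpow, ?_, cubeRoot_ne_one.symm, ?_, ?_, ?_, ?_⟩
  · rw [← pow_mul, mul_comm, pow_mul, hpow, one_pow]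
  · exact (isPrimitiveRoot_cubeRoot.pow_ne_one_of_pos_of_lt two_ne_zero (by norm_num)).symm
  · exact fun h => cubeRoot_ne_one (mul_left_cancel₀ h0 (by linear_combination -h))
  · linear_combination h3
  · linear_combination -cubeRoot_sq

/-- The real triple points are the numbers `1 + 2 cos(2πj/n)` with `0 < j < n/2`. -/
theorem ncard_real_TriplePts {n : ℕ} (hn : 0 < n) :
    {z ∈ TriplePts n | (starRingEnd ℂ) z = z}.ncard = (n - 1) / 2 := by
  have hp := Complex.isPrimitiveRoot_exp n hn.ne'
  have hn0 : (0 : ℝ) < n := by exact_mod_cast hn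
  let f : ℕ → ℂ := fun j => 1 + Ppt n j + (Ppt n j)⁻¹
  have hf : ∀ j, f j = ((1 + 2 * Real.cos (2 * Real.pi * j / n) : ℝ) : ℂ) := by
    intro j
    have h : Ppt n j = Complex.exp (((2 * Real.pi * j / n : ℝ) : ℂ) * Complex.I) := by
      rw [Ppt]
      congr 1
      push_cast
      ring
    simp only [f]
    rw [h, ← Complex.exp_neg]
    push_cast
    rw [Complex.two_cos, neg_mul]
    ring
  have hinj : Set.InjOn f (Finset.Icc 1 ((n - 1) / 2)) := by
    have hbound : ∀ j ∈ (Finset.Icc 1 ((n - 1) / 2) : Set ℕ),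
        2 * Real.pi * j / n ∈ Set.Icc 0 Real.pi := by
      intro j hj
      have hj' : 2 * j ≤ n := by
        have := (Finset.mem_Icc.mp hj).2
        omega
      have hj'' : (2 : ℝ) * j ≤ n := by exact_mod_cast hj'
      refine ⟨by positivity, ?_⟩
      rw [div_le_iff₀ hn0]
      nlinarith [Real.pi_pos]
    intro i hi j hj hij
    rw [hf, hf] at hij
    have hcos := Complex.ofReal_injective hij
    have := Real.injOn_cos (hbound i hi) (hbound j hj) (by linarith)
    field_simp at this
    exact_mod_cast this
  have himg : {z ∈ TriplePts n | (starRingEnd ℂ) z = z} = f '' (Finset.Icc 1 ((n - 1) / 2)) := by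
    ext z
    constructor
    · rintro ⟨hz, hreal⟩
      have h1 : (1 : ℂ) ∈ cubicRoots n z :=
        (mem_cubicRoots hn).mpr ⟨one_pow n, by rw [hreal]; ring⟩
      obtain ⟨a, b, ha, hb, hab⟩ : ∃ a b, (a ∈ cubicRoots n z ∧ a ≠ 1) ∧
          (b ∈ cubicRoots n z ∧ b ≠ 1) ∧ a ≠ b := by
        have : 1 < ((cubicRoots n z).erase 1).card := by
          rw [Finset.card_erase_of_mem h1, card_cubicRoots hn hz]
          norm_num
        obtain ⟨a, b, ha, hb, hab⟩ := Finset.one_lt_card_iff.mp this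
        rw [Finset.mem_erase] at ha hb
        exact ⟨a, b, ha.symm, hb.symm, hab⟩
      have h := mul_eq_one_of_mem_cubicRoots hn h1 ha.1 hb.1 ha.2.symm hb.2.symm hab
      rw [one_mul] at h
      have hz' := eq_of_mem_cubicRoots hn h1 ha.1 ha.2.symm
      rw [one_mul] at hz'
      obtain ⟨j, hj, rfl⟩ : ∃ j < n, Ppt n j = a := by
        have : NeZero n := ⟨hn.ne'⟩
        obtain ⟨j, hj, h⟩ := hp.eq_pow_of_pow_eq_one ((mem_cubicRoots hn).mp ha.1).1
        exact ⟨j, hj, (Ppt_eq_pow n j).trans h⟩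
      have hj0 : j ≠ 0 := by
        rintro rfl
        exact ha.2 (by rw [Ppt_eq_pow, pow_zero])
      have hinv : Ppt n (n - j) = (Ppt n j)⁻¹ := by
        refine (inv_eq_of_mul_eq_one_right ?_).symm
        rw [Ppt_eq_pow, Ppt_eq_pow, ← pow_add, Nat.add_sub_cancel' hj.le, hp.pow_eq_one]
      have hj2 : n - j ≠ j := by
        intro h'
        rw [h', eq_comm, inv_eq_of_mul_eq_one_right h] at hinv
        exact hab hinv.symm
      rcases lt_or_gt_of_ne hj2 with hlt | hlt
      · refine ⟨n - j, Finset.mem_coe.mpr (Finset.mem_Icc.mpr (by omega)), ?_⟩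
        simp only [f]
        rw [hinv, inv_inv, hz']
        ring
      · exact ⟨j, Finset.mem_coe.mpr (Finset.mem_Icc.mpr (by omega)), hz'.symm⟩
    · rintro ⟨j, hj, rfl⟩
      have hj' := Finset.mem_Icc.mp hj
      refine ⟨?_, by rw [hf, Complex.conj_ofReal]⟩
      have ha := Ppt_pow hn j
      have ha0 := ne_zero_of_pow_eq_one hn ha
      have ha1 : Ppt n j ≠ 1 := by
        rw [Ppt_eq_pow]
        exact hp.pow_ne_one_of_pos_of_lt (by omega) (by omega)
      have ha2 : Ppt n j ^ 2 ≠ 1 := by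
        rw [Ppt_eq_pow, ← pow_mul]
        exact hp.pow_ne_one_of_pos_of_lt (by omega) (by omega)
      rw [mem_TriplePts_iff_exists hn]
      refine ⟨1, Ppt n j, (Ppt n j)⁻¹, one_pow n, ha, by rw [inv_pow, ha, inv_one], ha1.symm,
        ?_, ?_, ?_, rfl⟩
      · exact fun h => ha1 (inv_eq_one.mp h.symm)
      · intro h
        apply ha2
        have h' := mul_inv_cancel₀ ha0
        rw [← h] at h'
        rw [sq, h']
      · rw [one_mul, mul_inv_cancel₀ ha0]
  rw [himg, hinj.ncard_image, Set.ncard_coe_finset, Nat.card_Icc, Nat.add_sub_cancel]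

theorem setOf_Gorbit_ncard_three_eq {n : ℕ} (hn : 0 < n) (hdvd : 3 ∣ n) :
    {O : Set ℂ | ∃ p ∈ TriplePts n, O = Gorbit p ∧ O.ncard = 3} =
      Gorbit '' ({z ∈ TriplePts n | (starRingEnd ℂ) z = z} \ {0}) := by
  ext O
  constructor
  · rintro ⟨p, hp, rfl, h⟩
    have hp0 : p ≠ 0 := by
      rintro rfl
      rw [Gorbit_zero, Set.ncard_singleton] at h
      omega
    obtain ⟨u, hu, hur⟩ : ∃ u ∈ Gorbit p, (starRingEnd ℂ) u = u := by
      by_contra! hne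
      have := ncard_Gorbit_of_forall_not_real hp0 hne
      omega
    have heq := Gorbit_eq_iff.mpr hu
    refine ⟨u, ⟨⟨mem_TriplePts_of_mem_Gorbit hn hdvd hp hu, hur⟩, ?_⟩, heq⟩
    rintro rfl
    rw [← heq, Gorbit_zero, Set.ncard_singleton] at h
    omega
  · rintro ⟨z, ⟨⟨hz, hr⟩, h0⟩, rfl⟩
    exact ⟨z, hz, rfl, ncard_Gorbit_of_real h0 hr⟩

theorem ncard_orbits_three {n : ℕ} (hn : 0 < n) (hdvd : 3 ∣ n) :
    {O : Set ℂ | ∃ p ∈ TriplePts n, O = Gorbit p ∧ O.ncard = 3}.ncard = (n - 1) / 2 - 1 := by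
  have hinj : Set.InjOn Gorbit ({z ∈ TriplePts n | (starRingEnd ℂ) z = z} \ {0}) := by
    rintro u ⟨⟨-, hu⟩, -⟩ v ⟨⟨-, hv⟩, -⟩ h
    exact eq_of_real_of_mem_Gorbit hu hv (Gorbit_eq_iff.mp h)
  have h0 : (0 : ℂ) ∈ {z ∈ TriplePts n | (starRingEnd ℂ) z = z} :=
    ⟨zero_mem_TriplePts hn hdvd, map_zero _⟩
  rw [setOf_Gorbit_ncard_three_eq hn hdvd, hinj.ncard_image,
    Set.ncard_sdiff_singleton_of_mem h0, ncard_real_TriplePts hn]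

theorem ncard_Gorbit_eq (v : ℂ) :
    (Gorbit v).ncard = 1 ∧ v = 0 ∨ (Gorbit v).ncard = 3 ∨ (Gorbit v).ncard = 6 := by
  rcases eq_or_ne v 0 with rfl | hv
  · exact Or.inl ⟨by rw [Gorbit_zero, Set.ncard_singleton], rfl⟩
  · right
    by_cases h : ∃ u ∈ Gorbit v, (starRingEnd ℂ) u = u
    · obtain ⟨u, hu, hur⟩ := h
      rw [← Gorbit_eq_iff.mpr hu]
      refine Or.inl (ncard_Gorbit_of_real ?_ hur)
      rintro rfl
      have := mem_Gorbit_self v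
      rw [← Gorbit_eq_iff.mpr hu, Gorbit_zero] at this
      exact hv this
    · push Not at h
      exact Or.inr (ncard_Gorbit_of_forall_not_real hv h)

open scoped Classical in
/-- The class equation for the action on the set of triple points. -/
theorem ncard_TriplePts_eq {n : ℕ} (hn : 0 < n) (hdvd : 3 ∣ n) :
    (TriplePts n).ncard =
      1 + 3 * {O : Set ℂ | ∃ p ∈ TriplePts n, O = Gorbit p ∧ O.ncard = 3}.ncard +
        6 * {O : Set ℂ | ∃ p ∈ TriplePts n, O = Gorbit p ∧ O.ncard = 6}.ncard := by
  set B := (finite_TriplePts hn).toFinset with hB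
  have hmem : ∀ z, z ∈ B ↔ z ∈ TriplePts n := fun z => Set.Finite.mem_toFinset _
  have hfilter : ∀ k, {O : Set ℂ | ∃ p ∈ TriplePts n, O = Gorbit p ∧ O.ncard = k} =
      (((B.image Gorbit).filter fun O => O.ncard = k : Finset (Set ℂ)) : Set (Set ℂ)) := by
    intro k
    ext O
    simp only [Set.mem_ofPred_eq, Finset.coe_filter, Finset.mem_image, hmem]
    constructor
    · rintro ⟨p, hp, rfl, h⟩
      exact ⟨⟨p, hp, rfl⟩, h⟩
    · rintro ⟨⟨p, hp, rfl⟩, h⟩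
      exact ⟨p, hp, rfl, h⟩
  have hone : ((B.image Gorbit).filter fun O => O.ncard = 1) = {{0}} := by
    ext O
    simp only [Finset.mem_filter, Finset.mem_image, Finset.mem_singleton, hmem]
    constructor
    · rintro ⟨⟨p, -, rfl⟩, h⟩
      rcases ncard_Gorbit_eq p with ⟨-, rfl⟩ | h' | h'
      · exact Gorbit_zero
      all_goals omega
    · rintro rfl
      exact ⟨⟨0, zero_mem_TriplePts hn hdvd, Gorbit_zero⟩, Set.ncard_singleton _⟩
  have hsum : ∀ O ∈ B.image Gorbit, (B.filter fun p => Gorbit p = O).card =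
      (if O.ncard = 1 then 1 else 0) + (if O.ncard = 3 then 3 else 0) +
        (if O.ncard = 6 then 6 else 0) := by
    intro O hO
    obtain ⟨p, hp, rfl⟩ := Finset.mem_image.mp hO
    have hset : ((B.filter fun q => Gorbit q = Gorbit p : Finset ℂ) : Set ℂ) = Gorbit p := by
      ext q
      rw [Finset.mem_coe, Finset.mem_filter, Gorbit_eq_iff, hmem]
      exact ⟨And.right, fun h =>
        ⟨mem_TriplePts_of_mem_Gorbit hn hdvd ((hmem p).mp hp) h, h⟩⟩
    rw [← Set.ncard_coe_finset, hset]
    rcases ncard_Gorbit_eq p with ⟨h, -⟩ | h | h <;> simp [h]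
  rw [hfilter, hfilter, Set.ncard_coe_finset, Set.ncard_coe_finset,
    Set.ncard_eq_toFinset_card _ (finite_TriplePts hn), ← hB,
    Finset.card_eq_sum_card_image Gorbit B, Finset.sum_congr rfl hsum, Finset.sum_add_distrib,
    Finset.sum_add_distrib, ← Finset.sum_filter, ← Finset.sum_filter, ← Finset.sum_filter,
    Finset.sum_const, Finset.sum_const, Finset.sum_const, hone, Finset.card_singleton]
  simp only [smul_eq_mul]
  ring

/-- For `3 ∣ n`, the number of `G`-orbits of cardinality 3 in the set of triple
points is `⌊(n-1)/2⌋ - 1`, and the number `N₆` of orbits of cardinality 6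
satisfies `36·N₆ = n(n-3) - 18·⌊(n-1)/2⌋ + 18`. -/
theorem boroczky_orbit_counts (n : ℕ) (hn : 3 ≤ n) (hdvd : 3 ∣ n) :
    ({O : Set ℂ | ∃ p ∈ TriplePts n, O = Gorbit p ∧ O.ncard = 3} : Set (Set ℂ)).ncard =
      (n - 1) / 2 - 1 ∧
    (36 : ℤ) *
        (({O : Set ℂ | ∃ p ∈ TriplePts n, O = Gorbit p ∧ O.ncard = 6} : Set (Set ℂ)).ncard : ℤ) =
      (n : ℤ) * ((n : ℤ) - 3) - 18 * (((n - 1) / 2 : ℕ) : ℤ) + 18 := by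
  have hpos : 0 < n := by omega
  have h3 := ncard_orbits_three hpos hdvd
  have hB := six_mul_ncard_TriplePts hpos hdvd
  rw [ncard_TriplePts_eq hpos hdvd, h3] at hB
  refine ⟨h3, ?_⟩
  have hhalf : 1 ≤ (n - 1) / 2 := by omega
  generalize (n - 1) / 2 = m at *
  generalize Set.ncard _ = N at hB ⊢
  zify [hhalf] at hB
  linear_combination hB
end
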